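/- For all integers n ≥ 0 and ℓ ≥ 2, PD_{2^ℓ}(2n) ≡ a*_{n,ℓ} (mod 2), where a*_{n,ℓ} denotes the number of pairs (k_0, k_1) of nonnegative integers such that n = k_0² + 2^{ℓ-1} k_1² and, for each i ∈ {0,1}, either k_i = 0 or 3 does not divide k_i. -/

import Mathlib

/-- `PD k n` is the number of partitions of `n` with designated summands whose parts are
not divisible by `k`: the sum over partitions of `n` with no part divisible by `k` of the
product of the multiplicities of the distinct part sizes. -/
def PD (k n : ℕ) : ℕ :=
  ∑ p : n.Partition,
    if ∀ s ∈ p.parts, ¬ k ∣ s then ∏ s ∈ p.parts.toFinset, p.parts.count s else 0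

open PowerSeries

/-- The mod `2` generating series of a weight function, with junk value `0` at infinite fibres. -/
noncomputable def fiberSeries {ι : Type*} (e : ι → ℕ) : (ZMod 2)⟦X⟧ :=
  .mk fun n ↦ (Nat.card {i // e i = n} : ZMod 2)

section fiberSeries

variable {ι κ : Type*}

theorem coeff_fiberSeries (e : ι → ℕ) (n : ℕ) :
    (fiberSeries e).coeff n = (Nat.card {i // e i = n} : ZMod 2) :=
  coeff_mk _ _

theorem fiberSeries_congr {e : ι → ℕ} {e' : κ → ℕ} (σ : ι ≃ κ) (h : ∀ i, e' (σ i) = e i) :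
    fiberSeries e = fiberSeries e' := by
  ext n
  rw [coeff_fiberSeries, coeff_fiberSeries,
    Nat.card_congr (σ.subtypeEquiv (q := fun k ↦ e' k = n) fun i ↦ by rw [h])]

theorem fiberSeries_mul {e : ι → ℕ} {e' : κ → ℕ} (he : ∀ n, Finite {i // e i = n})
    (he' : ∀ n, Finite {k // e' k = n}) :
    fiberSeries e * fiberSeries e' = fiberSeries fun p : ι × κ ↦ e p.1 + e' p.2 := by
  ext n
  rw [coeff_mul, coeff_fiberSeries]
  have σ : {p : ι × κ // e p.1 + e' p.2 = n} ≃
      Σ q : Finset.HasAntidiagonal.antidiagonal n, {i // e i = q.1.1} × {k // e' k = q.1.2} :=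
    { toFun p := ⟨⟨(e p.1.1, e' p.1.2), by simpa using p.2⟩, ⟨p.1.1, rfl⟩, ⟨p.1.2, rfl⟩⟩
      invFun q := ⟨(q.2.1.1, q.2.2.1), by
        rw [q.2.1.2, q.2.2.2]; exact Finset.HasAntidiagonal.mem_antidiagonal.mp q.1.2⟩
      left_inv p := rfl
      right_inv := by
        rintro ⟨⟨⟨a, b⟩, h⟩, ⟨i, hi⟩, ⟨k, hk⟩⟩
        dsimp only at hi hk
        subst hi hk
        rfl }
  rw [Nat.card_congr σ, Nat.card_sigma]
  simp only [Nat.card_prod, Nat.cast_sum, Nat.cast_mul, coeff_fiberSeries]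
  exact (Finset.sum_coe_sort (Finset.HasAntidiagonal.antidiagonal n) fun q ↦
    (Nat.card {i // e i = q.1} : ZMod 2) * (Nat.card {k // e' k = q.2} : ZMod 2)).symm

theorem expand_fiberSeries (e : ι → ℕ) {k : ℕ} (hk : k ≠ 0) :
    expand k hk (fiberSeries e) = fiberSeries fun i ↦ k * e i := by
  ext n
  rw [coeff_expand, coeff_fiberSeries, coeff_fiberSeries]
  split_ifs with h
  · obtain ⟨m, rfl⟩ := h
    simp [hk]
  · have : IsEmpty {i // k * e i = n} := ⟨fun i ↦ h ⟨_, i.2.symm⟩⟩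
    simp

/-- The points moved by a weight-preserving involution do not contribute modulo `2`. -/
theorem fiberSeries_eq_of_involutive {e : ι → ℕ} (he : ∀ n, Finite {i // e i = n})
    {f : ι → ι} (hf : f.Involutive) (hef : ∀ i, e (f i) = e i) :
    fiberSeries e = fiberSeries fun i : {i // f i = i} ↦ e i := by
  classical
  ext n
  rw [coeff_fiberSeries, coeff_fiberSeries, ZMod.natCast_eq_natCast_iff]
  have := Fintype.ofFinite {i // e i = n}
  let g : Function.End {i // e i = n} := fun i ↦ ⟨f i, by rw [hef, i.2]⟩
  have hg : g ^ 2 ^ 1 = 1 := by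
    rw [pow_one, pow_two]
    funext i
    exact Subtype.ext (hf i)
  have hcard := Equiv.Perm.card_fixedPoints_modEq (p := 2) hg
  rw [← Nat.card_eq_fintype_card, ← Nat.card_eq_fintype_card] at hcard
  refine hcard.trans (congrArg (· % 2) (Nat.card_congr ?_))
  exact
    { toFun i := ⟨⟨i.1.1, congrArg Subtype.val i.2⟩, i.1.2⟩
      invFun i := ⟨⟨i.1.1, i.2⟩, Subtype.ext i.1.2⟩
      left_inv _ := rfl
      right_inv _ := rfl }

end fiberSeries

/-- The natural numbers that are zero or prime to `3`. -/
abbrev ThetaIndex : Type := {k : ℕ // k = 0 ∨ ¬ 3 ∣ k}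

/-- The theta series `∑ X ^ k ^ 2` modulo `2`, over `k = 0` and `k` prime to `3`. -/
noncomputable def theta : (ZMod 2)⟦X⟧ := fiberSeries fun k : ThetaIndex ↦ k.1 ^ 2

theorem finite_thetaIndex_fiber (n : ℕ) : Finite {k : ThetaIndex // k.1 ^ 2 = n} :=
  Finite.of_injective
    (fun k ↦ (⟨k.1.1, (Nat.le_self_pow two_ne_zero k.1.1).trans k.2.le⟩ : Set.Iic n))
    fun a b h ↦ by simpa [Subtype.ext_iff] using h

theorem finite_of_natAbs_le {ι : Type*} (f : ι → ℤ) (hf : f.Injective) (e : ι → ℕ) (n : ℕ)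
    (h : ∀ i, (f i).natAbs ≤ e i) : Finite {i // e i = n} := by
  refine Finite.of_injective (β := Set.Icc (-n : ℤ) n) (fun i ↦ ⟨f i, ?_⟩) fun a b h ↦ ?_
  · have := h i
    have := i.2
    constructor <;> omega
  · simpa [Subtype.ext_iff, hf.eq_iff] using h

theorem natAbs_le_pentagonal (k : ℤ) : k.natAbs ≤ pentagonal k := by
  have := two_mul_natCast_pentagonal k
  zify
  rcases abs_cases k with ⟨h, _⟩ | ⟨h, _⟩ <;> rw [h] <;> nlinarith [sq_nonneg (k - 1), sq_nonneg k]

theorem pentagonalSeries_eq_fiberSeries : pentagonalSeries (ZMod 2) = fiberSeries pentagonal := by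
  ext n
  rw [coeff_fiberSeries]
  by_cases h : n ∈ Set.range pentagonal
  · obtain ⟨k, rfl⟩ := h
    rw [coeff_pentagonalSeries_pentagonal]
    have : Subsingleton {i // pentagonal i = pentagonal k} :=
      ⟨fun a b ↦ Subtype.ext (pentagonal_injective (a.2.trans b.2.symm))⟩
    have : Nonempty {i // pentagonal i = pentagonal k} := ⟨⟨k, rfl⟩⟩
    rw [Nat.card_of_subsingleton this.some]
    rcases Int.even_or_odd k with hk | hk
    · simp [Int.negOnePow_even k hk]
    · simp [Int.negOnePow_odd k hk]
  · rw [coeff_pentagonalSeries_eq_zero _ h]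
    have : IsEmpty {i // pentagonal i = n} := ⟨fun i ↦ h ⟨_, i.2⟩⟩
    simp

theorem expand_two_pow (m : ℕ) (f : (ZMod 2)⟦X⟧) :
    expand (2 ^ m) (by positivity) f = f ^ 2 ^ m := by
  have := MvPowerSeries.map_iterateFrobenius_expand (R := ZMod 2) (σ := Unit) 2 two_ne_zero f m
  rwa [show iterateFrobenius (ZMod 2) 2 m = RingHom.id _ from Subsingleton.elim _ _,
    MvPowerSeries.map_id] at this

theorem expand_two (f : (ZMod 2)⟦X⟧) : expand 2 two_ne_zero f = f ^ 2 := by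
  simpa using expand_two_pow 1 f

/-- An involution of `ℤ × ℤ` preserving `cubeWeight`. -/
def cubeInvol (p : ℤ × ℤ) : ℤ × ℤ :=
  if p.2 % 3 = 0 then (p.1 + 4 * (p.2 / 3), -p.2)
  else if p.2 % 3 = 1 then (-p.1 - 4 * (p.2 / 3) - 1, p.2) else p

theorem cubeInvol_involutive : cubeInvol.Involutive := by
  rintro ⟨a, m⟩
  unfold cubeInvol
  split_ifs <;> simp_all <;> omega

/-- The exponents in the product of `pentagonalSeries` and its image under `X ↦ X ^ 2`. -/
def cubeWeight (p : ℤ × ℤ) : ℕ := pentagonal p.1 + 2 * pentagonal (p.1 + p.2)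

theorem two_mul_cubeWeight (p : ℤ × ℤ) : 2 * (cubeWeight p : ℤ) =
    p.1 * (3 * p.1 - 1) + 2 * ((p.1 + p.2) * (3 * (p.1 + p.2) - 1)) := by
  rw [cubeWeight]
  push_cast
  linarith [two_mul_natCast_pentagonal p.1, two_mul_natCast_pentagonal (p.1 + p.2)]

theorem cubeWeight_cubeInvol (p : ℤ × ℤ) : cubeWeight (cubeInvol p) = cubeWeight p := by
  zify
  refine mul_left_cancel₀ two_ne_zero ?_
  rw [two_mul_cubeWeight, two_mul_cubeWeight]
  obtain ⟨a, m⟩ := p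
  unfold cubeInvol
  split_ifs with h h
  · obtain ⟨j, rfl⟩ := Int.dvd_of_emod_eq_zero h
    rw [Int.mul_ediv_cancel_left _ three_ne_zero]
    ring
  · obtain ⟨j, rfl⟩ : ∃ j, m = 3 * j + 1 := ⟨m / 3, by omega⟩
    rw [show (3 * j + 1) / 3 = j by omega]
    ring
  · rfl

/-- A signed version of `ThetaIndex`, fixing the sign by the residue modulo `3`. -/
abbrev SignedThetaIndex : Type := {m : ℤ // m = 0 ∨ m % 3 = 2}

theorem signedThetaIndex_natAbs_bijective : Function.Bijective
    fun m : SignedThetaIndex ↦ (⟨m.1.natAbs, by have := m.2; omega⟩ : ThetaIndex) := by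
  refine ⟨fun a b h ↦ ?_, fun k ↦ ?_⟩
  · have ha := a.2
    have hb := b.2
    simp only [Subtype.mk.injEq] at h
    ext
    omega
  · obtain ⟨k, hk⟩ := k
    by_cases h : (k : ℤ) = 0 ∨ (k : ℤ) % 3 = 2
    · exact ⟨⟨k, h⟩, by simp⟩
    · exact ⟨⟨-k, by omega⟩, by simp⟩

theorem cubeInvol_eq_self_iff (p : ℤ × ℤ) : cubeInvol p = p ↔ (p.2 = 0 ∨ p.2 % 3 = 2) := by
  obtain ⟨a, m⟩ := p
  unfold cubeInvol
  split_ifs <;> simp <;> omega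

/-- For each `m`, the involution of `ℤ` completing the square in `cubeWeight (·, m)`. -/
def thetaReparam (m a : ℤ) : ℤ := if m = 0 then a else 1 - a - 2 * ((m + 1) / 3)

theorem thetaReparam_thetaReparam (m a : ℤ) : thetaReparam m (thetaReparam m a) = a := by
  unfold thetaReparam; split_ifs <;> ring

/-- The fixed points of `cubeInvol`, in coordinates separating the variables of `cubeWeight`. -/
def cubeInvolFixedEquiv : {p : ℤ × ℤ // cubeInvol p = p} ≃ ℤ × SignedThetaIndex where
  toFun p := (thetaReparam p.1.2 p.1.1, ⟨p.1.2, (cubeInvol_eq_self_iff p.1).mp p.2⟩)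
  invFun q := ⟨(thetaReparam q.2.1 q.1, q.2.1), (cubeInvol_eq_self_iff _).mpr q.2.2⟩
  left_inv p := by ext <;> simp [thetaReparam_thetaReparam]
  right_inv q := by ext <;> simp [thetaReparam_thetaReparam]

theorem cubeWeight_eq_thetaReparam (c : ℤ) (m : ℤ) (hm : m = 0 ∨ m % 3 = 2) :
    3 * pentagonal (thetaReparam m c) + m.natAbs ^ 2 = cubeWeight (c, m) := by
  zify
  refine mul_left_cancel₀ two_ne_zero ?_
  rw [two_mul_cubeWeight, mul_add, mul_left_comm, two_mul_natCast_pentagonal, sq_abs]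
  unfold thetaReparam
  split_ifs with h
  · subst h
    ring
  · obtain ⟨j, rfl⟩ : ∃ j, m = 3 * j - 1 := ⟨(m + 1) / 3, by omega⟩
    rw [show (3 * j - 1 + 1) / 3 = j by omega]
    ring

theorem finite_mul_pentagonal_fiber (k : ℕ) (hk : k ≠ 0) (n : ℕ) : Finite {i // k * pentagonal i = n} :=
  finite_of_natAbs_le id Function.injective_id _ _ fun i ↦
    (natAbs_le_pentagonal i).trans (Nat.le_mul_of_pos_left _ (Nat.pos_of_ne_zero hk))

theorem finite_setOf_le {ι : Type*} {e : ι → ℕ} (he : ∀ n, Finite {i // e i = n}) (n : ℕ) :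
    {i | e i ≤ n}.Finite := by
  have : {i | e i ≤ n} = ⋃ m ∈ Set.Iic n, {i | e i = m} := by ext; simp
  rw [this]
  exact (Set.finite_Iic n).biUnion fun m _ ↦ he m

theorem finite_fiber_add {ι κ : Type*} {e : ι → ℕ} {e' : κ → ℕ}
    (he : ∀ n, Finite {i // e i = n}) (he' : ∀ n, Finite {k // e' k = n}) (n : ℕ) :
    Finite {p : ι × κ // e p.1 + e' p.2 = n} :=
  ((finite_setOf_le he n).prod (finite_setOf_le he' n)).subset
    fun _ (hp : _ + _ = n) ↦ ⟨(Nat.le_add_right _ _).trans hp.le, (Nat.le_add_left _ _).trans hp.le⟩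

/-- Modulo `2`, the cube of `∏ (1 - q ^ n)` is `∏ (1 - q ^ (3 * n))` times a theta series. -/
theorem pentagonalSeries_cube :
    pentagonalSeries (ZMod 2) ^ 3 = expand 3 three_ne_zero (pentagonalSeries (ZMod 2)) * theta := by
  have h1 := finite_mul_pentagonal_fiber 1 one_ne_zero
  simp only [one_mul] at h1
  have h2 := finite_mul_pentagonal_fiber 2 two_ne_zero
  have h3 := finite_mul_pentagonal_fiber 3 three_ne_zero
  let σ : ℤ × ℤ ≃ ℤ × ℤ :=
    { toFun p := (p.1, p.1 + p.2)
      invFun p := (p.1, p.2 - p.1)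
      left_inv p := by simp
      right_inv p := by simp }
  have hσ : fiberSeries cubeWeight =
      fiberSeries fun p : ℤ × ℤ ↦ pentagonal p.1 + 2 * pentagonal p.2 :=
    fiberSeries_congr σ fun _ ↦ rfl
  have hfin : ∀ n, Finite {p // cubeWeight p = n} := fun n ↦
    have := finite_fiber_add h1 h2 n
    Finite.of_equiv _ (σ.subtypeEquiv (p := fun p ↦ cubeWeight p = n)
      (q := fun p ↦ pentagonal p.1 + 2 * pentagonal p.2 = n) fun _ ↦ Iff.rfl).symm
  rw [pow_succ', ← expand_two, pentagonalSeries_eq_fiberSeries, expand_fiberSeries, expand_fiberSeries,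
    fiberSeries_mul h1 h2, theta, fiberSeries_mul h3 finite_thetaIndex_fiber, ← hσ,
    fiberSeries_eq_of_involutive hfin cubeInvol_involutive cubeWeight_cubeInvol]
  refine fiberSeries_congr (cubeInvolFixedEquiv.trans
    ((Equiv.refl ℤ).prodCongr (Equiv.ofBijective _ signedThetaIndex_natAbs_bijective))) fun p ↦ ?_
  exact cubeWeight_eq_thetaReparam p.1.1 p.1.2 ((cubeInvol_eq_self_iff p.1).mp p.2)

open scoped PowerSeries.WithPiTopology in
theorem continuous_expand {R : Type*} [CommRing R] [TopologicalSpace R] {k : ℕ} (hk : k ≠ 0) :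
    Continuous (expand k hk : R⟦X⟧ →ₐ[R] R⟦X⟧) := by
  refine continuous_iff_continuousAt.mpr fun f ↦ ?_
  rw [ContinuousAt, WithPiTopology.tendsto_iff_coeff_tendsto]
  intro d
  simp only [coeff_expand]
  split_ifs
  · exact (WithPiTopology.continuous_coeff R _).tendsto f
  · exact tendsto_const_nhds

/-- The series `1 + ∑ m X ^ m`: the contribution of the parts equal to `1`. -/
noncomputable def summandFactor : (ZMod 2)⟦X⟧ :=
  .mk fun n ↦ if n = 0 then 1 else n

theorem one_sub_X_pow_three_mul_summandFactor :
    (1 - X) ^ 3 * summandFactor = 1 - X ^ 3 := by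
  have h2 : (2 : (ZMod 2)⟦X⟧) = 0 := by
    rw [← map_ofNat (C (R := ZMod 2)) 2, show (OfNat.ofNat 2 : ZMod 2) = 0 from rfl, map_zero]
  have h : (1 + X ^ 2) * summandFactor = 1 + X + X ^ 2 := by
    ext n
    rw [add_mul, one_mul, map_add, coeff_X_pow_mul', map_add, map_add, coeff_one, coeff_X,
      coeff_X_pow, summandFactor, coeff_mk, coeff_mk]
    rcases n with _ | _ | _ | n
    · simp
    · simp
    · simp
      decide
    · simp
      linear_combination (n + 2 : ZMod 2) * (CharTwo.two_eq_zero : (2 : ZMod 2) = 0)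
  linear_combination (1 - X) * h - (1 - X) * X * summandFactor * h2

open scoped PowerSeries.WithPiTopology in
theorem one_add_tsum_eq_expand (s : ℕ) :
    1 + ∑' j, ((j + 1 : ℕ) : ZMod 2) • (X : (ZMod 2)⟦X⟧) ^ ((s + 1) * (j + 1)) =
      expand (s + 1) s.succ_ne_zero summandFactor := by
  have h := (hasSum_of_monomials_self summandFactor).map (expand (s + 1) s.succ_ne_zero)
    (continuous_expand _)
  rw [← h.tsum_eq, h.summable.tsum_eq_zero_add]
  congr 1
  · simp [summandFactor]
  · refine tsum_congr fun j ↦ ?_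
    simp [summandFactor, monomial_eq_C_mul_X_pow, smul_eq_C_mul, pow_mul]

/-- The generating series, modulo `2`, of partitions with designated summands in which
the parts divisible by `k` are excluded. -/
noncomputable def designatedSeries (k : ℕ) : (ZMod 2)⟦X⟧ :=
  .mk fun n ↦ (PD k n : ZMod 2)

open scoped PowerSeries.WithPiTopology in
theorem hasProd_designatedSeries (k : ℕ) :
    HasProd (fun i ↦ if k ∣ i + 1 then 1 else expand (i + 1) i.succ_ne_zero summandFactor)
      (designatedSeries k) := by
  convert! Nat.Partition.hasProd_genFun (fun i c ↦ if k ∣ i then (0 : ZMod 2) else c) using 1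
  · ext1 i
    split_ifs with h
    · simp
    · exact (one_add_tsum_eq_expand i).symm
  · ext n
    rw [designatedSeries, coeff_mk, Nat.Partition.coeff_genFun, PD, Nat.cast_sum]
    refine Finset.sum_congr rfl fun p _ ↦ ?_
    rw [Finsupp.prod, Multiset.toFinsupp_support]
    split_ifs with h
    · rw [Nat.cast_prod]
      refine Finset.prod_congr rfl fun s hs ↦ ?_
      rw [if_neg (h s (Multiset.mem_toFinset.mp hs)), Multiset.toFinsupp_apply]
    · push Not at h
      obtain ⟨s, hs, hks⟩ := h
      rw [Nat.cast_zero]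
      refine (Finset.prod_eq_zero (Multiset.mem_toFinset.mpr hs) ?_).symm
      exact if_pos hks

open scoped PowerSeries.WithPiTopology in
theorem hasProd_designatedSeries_zero :
    HasProd (fun i ↦ expand (i + 1) i.succ_ne_zero summandFactor) (designatedSeries 0) := by
  simpa using hasProd_designatedSeries 0

open scoped PowerSeries.WithPiTopology in
theorem designatedSeries_zero_eq_mul {k : ℕ} (hk : k ≠ 0) :
    designatedSeries 0 = designatedSeries k * expand k hk (designatedSeries 0) := by
  refine hasProd_designatedSeries_zero.unique ?_
  have h : HasProd (fun i ↦ if k ∣ i + 1 then expand (i + 1) i.succ_ne_zero summandFactor else 1)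
      (expand k hk (designatedSeries 0)) := by
    have hpos (i : ℕ) : k * (i + 1) - 1 + 1 = k * (i + 1) :=
      Nat.sub_add_cancel (Nat.mul_pos (Nat.pos_of_ne_zero hk) i.succ_pos)
    have hinj : Function.Injective fun i ↦ k * (i + 1) - 1 := fun a b hab ↦ by
      have : k * (a + 1) = k * (b + 1) := by rw [← hpos a, ← hpos b]; exact congrArg (· + 1) hab
      simpa using Nat.eq_of_mul_eq_mul_left (Nat.pos_of_ne_zero hk) this
    refine (hinj.hasProd_iff fun i hi ↦ if_neg ?_).mp ?_
    · rintro ⟨j, hj⟩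
      obtain _ | j := j
      · simp at hj
      · exact hi ⟨j, Nat.sub_eq_of_eq_add hj.symm⟩
    · convert! hasProd_designatedSeries_zero.map (expand k hk) (continuous_expand hk) using 1
      funext i
      simp only [Function.comp_apply, hpos, dvd_mul_right, if_true]
      exact expand_mul k hk (i + 1) i.succ_ne_zero _
  convert! (hasProd_designatedSeries k).mul h using 2 with i
  split_ifs <;> simp

open scoped PowerSeries.WithPiTopology in
theorem designatedSeries_zero_mul_pentagonalSeries_cube :
    designatedSeries 0 * pentagonalSeries (ZMod 2) ^ 3 =
      expand 3 three_ne_zero (pentagonalSeries (ZMod 2)) := by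
  have hp := WithPiTopology.hasProd_one_sub_X_pow (ZMod 2)
  refine HasProd.unique ?_ (hp.map (expand 3 three_ne_zero) (continuous_expand _))
  rw [pow_succ, pow_two]
  convert! hasProd_designatedSeries_zero.mul ((hp.mul hp).mul hp) using 2 with i
  have := congrArg (expand (i + 1) i.succ_ne_zero) one_sub_X_pow_three_mul_summandFactor
  simp only [map_mul, map_pow, map_sub, map_one, expand_X] at this
  simp only [Function.comp_apply, map_sub, map_one, map_pow, expand_X]
  rw [← pow_mul, mul_comm 3, pow_mul, ← this]
  ring

theorem coeff_two_mul_mul_expand {R : Type*} [CommRing R] (f g : R⟦X⟧) (n : ℕ) :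
    (f * expand 2 two_ne_zero g).coeff (2 * n) =
      ((mk fun m ↦ f.coeff (2 * m)) * g).coeff n := by
  rw [coeff_mul, coeff_mul]
  symm
  refine Finset.sum_of_injOn (fun p ↦ (2 * p.1, 2 * p.2)) ?_ ?_ ?_ ?_
  · rintro ⟨a, b⟩ - ⟨c, d⟩ - h
    simpa using h
  · rintro ⟨a, b⟩ h
    simp at h ⊢
    omega
  · rintro ⟨a, b⟩ h h'
    rw [coeff_expand_of_not_dvd, mul_zero]
    rintro ⟨c, rfl⟩
    simp at h h'
    exact h' (a / 2) (by omega) (by omega)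
  · rintro ⟨a, b⟩ -
    simp [coeff_expand_mul]

theorem coeff_two_mul_theta (n : ℕ) : theta.coeff (2 * n) = (theta ^ 2).coeff n := by
  have h : expand 4 four_ne_zero theta = expand 2 two_ne_zero (theta ^ 2) := by
    rw [← expand_two, ← expand_mul]
  rw [← coeff_expand_mul 2 two_ne_zero (theta ^ 2), ← h, theta, expand_fiberSeries,
    coeff_fiberSeries, coeff_fiberSeries]
  congr 1
  refine (Nat.card_congr (Equiv.ofBijective
    (fun j ↦ ⟨⟨2 * j.1.1, by have := j.1.2; omega⟩,
      (by ring : (2 * j.1.1) ^ 2 = 4 * j.1.1 ^ 2).trans j.2⟩) ⟨fun a b hab ↦ ?_, ?_⟩)).symm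
  · simpa [Subtype.ext_iff] using hab
  · rintro ⟨⟨k, hk⟩, h⟩
    obtain ⟨j, rfl⟩ : 2 ∣ k := Nat.prime_two.dvd_of_dvd_pow ⟨n, h⟩
    exact ⟨⟨⟨j, by omega⟩, by rw [← h]; ring⟩, rfl⟩

theorem designatedSeries_zero_mul_theta : designatedSeries 0 * theta = 1 := by
  have h : expand 3 three_ne_zero (pentagonalSeries (ZMod 2)) ≠ 0 := by
    intro h
    have := congrArg (coeff (3 * pentagonal 0)) h
    rw [coeff_expand_mul, coeff_pentagonalSeries_pentagonal] at this
    simp at this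
  refine mul_left_cancel₀ h ?_
  rw [mul_left_comm, ← pentagonalSeries_cube, designatedSeries_zero_mul_pentagonalSeries_cube,
    mul_one]

theorem designatedSeries_two_pow (ℓ : ℕ) : designatedSeries (2 ^ ℓ) = theta ^ (2 ^ ℓ - 1) := by
  have h := designatedSeries_zero_eq_mul (k := 2 ^ ℓ) (by positivity)
  rw [expand_two_pow] at h
  have hθ := designatedSeries_zero_mul_theta
  calc designatedSeries (2 ^ ℓ)
      = designatedSeries (2 ^ ℓ) * (designatedSeries 0 * theta) ^ 2 ^ ℓ := by
        rw [hθ, one_pow, mul_one]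
    _ = designatedSeries 0 * theta * theta ^ (2 ^ ℓ - 1) := by
        rw [mul_pow, ← mul_assoc, ← h, mul_assoc, mul_pow_sub_one (by positivity)]
    _ = theta ^ (2 ^ ℓ - 1) := by rw [hθ, one_mul]

theorem coeff_two_mul_designatedSeries (n r : ℕ) :
    (designatedSeries (2 ^ (r + 2))).coeff (2 * n) =
      (theta * expand (2 ^ (r + 1)) (by positivity) theta).coeff n := by
  have hpos : 1 ≤ 2 ^ (r + 1) := Nat.one_le_two_pow
  have h1 : 2 ^ (r + 2) - 1 = 1 + (2 ^ (r + 1) - 1) * 2 := by rw [pow_succ _ (r + 1)]; omega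
  have h2 : (mk fun m ↦ theta.coeff (2 * m)) = theta ^ 2 := by
    ext m
    rw [coeff_mk, coeff_two_mul_theta]
  rw [designatedSeries_two_pow, h1, pow_add, pow_one, pow_mul, ← expand_two,
    coeff_two_mul_mul_expand, h2, expand_two_pow, ← pow_add, ← pow_succ']
  congr 2
  omega

theorem stmt_3 (n ℓ : ℕ) (hℓ : 2 ≤ ℓ) :
    PD (2 ^ ℓ) (2 * n) ≡
      Nat.card {p : ℕ × ℕ //
        n = p.1 ^ 2 + 2 ^ (ℓ - 1) * p.2 ^ 2 ∧
        (p.1 = 0 ∨ ¬ 3 ∣ p.1) ∧ (p.2 = 0 ∨ ¬ 3 ∣ p.2)} [MOD 2] := by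
  obtain ⟨r, rfl⟩ := Nat.exists_eq_add_of_le' hℓ
  have h := coeff_two_mul_designatedSeries n r
  have hfin (m : ℕ) : Finite {k : ThetaIndex // 2 ^ (r + 1) * k.1 ^ 2 = m} :=
    finite_of_natAbs_le (fun k : ThetaIndex ↦ (k.1 : ℤ))
      (Nat.cast_injective.comp Subtype.val_injective) _ _ fun k ↦
        (Nat.le_self_pow two_ne_zero k.1).trans (Nat.le_mul_of_pos_left _ (by positivity))
  rw [designatedSeries, coeff_mk, theta, expand_fiberSeries,
    fiberSeries_mul finite_thetaIndex_fiber hfin, coeff_fiberSeries,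
    ZMod.natCast_eq_natCast_iff] at h
  refine h.trans (congrArg (· % 2) (Nat.card_congr ?_))
  exact
    { toFun p := ⟨(p.1.1.1, p.1.2.1), p.2.symm, p.1.1.2, p.1.2.2⟩
      invFun p := ⟨(⟨p.1.1, p.2.2.1⟩, ⟨p.1.2, p.2.2.2⟩), p.2.1.symm⟩
      left_inv _ := rfl
      right_inv _ := rfl }
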